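/- For every tuple (a, b, c, d) ∈ ℕ⁴ with a ≤ n₀⁺, b ≤ n₁⁺, c ≤ n₀⁻, d ≤ n₁⁻, there exists a reconstruction s* : Fin N → Bool with change counts χ(s*) = (a, b, c, d) whose cost equals the RC_E-objective: cost(s*) = T_{G₀⁺}(a) + T_{G₁⁺}(b) + T_{G₀⁻}(c) + T_{G₁⁻}(d). Consequently, the minimum of cost(s*) over all reconstructions with change counts (a, b, c, d) equals T_{G₀⁺}(a) + T_{G₁⁺}(b) + T_{G₀⁻}(c) + T_{G₁⁻}(d). -/

import Mathlib

open Finset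

def G0p {N : ℕ} (sh yh : Fin N → Bool) : Finset (Fin N) :=
  univ.filter (fun i => sh i = false ∧ yh i = true)
def G1p {N : ℕ} (sh yh : Fin N → Bool) : Finset (Fin N) :=
  univ.filter (fun i => sh i = true ∧ yh i = true)
def G0m {N : ℕ} (sh yh : Fin N → Bool) : Finset (Fin N) :=
  univ.filter (fun i => sh i = false ∧ yh i = false)
def G1m {N : ℕ} (sh yh : Fin N → Bool) : Finset (Fin N) :=
  univ.filter (fun i => sh i = true ∧ yh i = false)

/-- a: changes 0→1 among positively-predicted examples -/
def chgA {N : ℕ} (sh yh s : Fin N → Bool) : ℕ :=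
  ((G0p sh yh).filter (fun i => s i = true)).card
/-- b: changes 1→0 among positively-predicted examples -/
def chgB {N : ℕ} (sh yh s : Fin N → Bool) : ℕ :=
  ((G1p sh yh).filter (fun i => s i = false)).card
/-- c: changes 0→1 among negatively-predicted examples -/
def chgC {N : ℕ} (sh yh s : Fin N → Bool) : ℕ :=
  ((G0m sh yh).filter (fun i => s i = true)).card
/-- d: changes 1→0 among negatively-predicted examples -/
def chgD {N : ℕ} (sh yh s : Fin N → Bool) : ℕ :=
  ((G1m sh yh).filter (fun i => s i = false)).card

/-- Cost of a reconstruction: total confidence of changed positions. -/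
def cost {N : ℕ} (sh : Fin N → Bool) (p : Fin N → ℝ) (s : Fin N → Bool) : ℝ :=
  ∑ i ∈ univ.filter (fun i => s i ≠ sh i), p i

/-- T_G(j): the minimum total confidence of a size-j subset of G
(i.e., the sum of the j smallest confidence scores in G). -/
noncomputable def Tmin {N : ℕ} (G : Finset (Fin N)) (p : Fin N → ℝ) (j : ℕ) : ℝ :=
  sInf {x : ℝ | ∃ A : Finset (Fin N), A ⊆ G ∧ A.card = j ∧ x = ∑ i ∈ A, p i}

/-- The RC_E objective at a change-count tuple (a,b,c,d). -/
noncomputable def objE {N : ℕ} (sh yh : Fin N → Bool) (p : Fin N → ℝ)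
    (a b c d : ℕ) : ℝ :=
  Tmin (G0p sh yh) p a + Tmin (G1p sh yh) p b +
    Tmin (G0m sh yh) p c + Tmin (G1m sh yh) p d

theorem finite_subset_sums {N : ℕ} (G : Finset (Fin N)) (p : Fin N → ℝ) (j : ℕ) :
    {x : ℝ | ∃ A : Finset (Fin N), A ⊆ G ∧ A.card = j ∧ x = ∑ i ∈ A, p i}.Finite :=
  (Set.finite_range fun A : Finset (Fin N) => ∑ i ∈ A, p i).subset
    fun _ ⟨A, _, _, hx⟩ => ⟨A, hx.symm⟩

theorem exists_subset_sum_eq_Tmin {N : ℕ} (G : Finset (Fin N)) (p : Fin N → ℝ) {j : ℕ}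
    (hj : j ≤ G.card) : ∃ A ⊆ G, A.card = j ∧ ∑ i ∈ A, p i = Tmin G p j := by
  obtain ⟨B, hBG, hB⟩ := exists_subset_card_eq hj
  have hne : {x : ℝ | ∃ A : Finset (Fin N), A ⊆ G ∧ A.card = j ∧ x = ∑ i ∈ A, p i}.Nonempty :=
    ⟨_, B, hBG, hB, rfl⟩
  obtain ⟨A, hAG, hA, hx⟩ := hne.csInf_mem (finite_subset_sums G p j)
  exact ⟨A, hAG, hA, hx.symm⟩

theorem Tmin_le_sum {N : ℕ} {G A : Finset (Fin N)} (p : Fin N → ℝ) (hA : A ⊆ G) :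
    Tmin G p A.card ≤ ∑ i ∈ A, p i :=
  csInf_le (finite_subset_sums G p A.card).bddBelow ⟨A, hA, rfl, rfl⟩

theorem cost_eq_sum_groups {N : ℕ} (sh yh : Fin N → Bool) (p : Fin N → ℝ) (s : Fin N → Bool) :
    cost sh p s =
      ∑ i ∈ (G0p sh yh).filter (fun i => s i = true), p i +
      ∑ i ∈ (G1p sh yh).filter (fun i => s i = false), p i +
      ∑ i ∈ (G0m sh yh).filter (fun i => s i = true), p i +
      ∑ i ∈ (G1m sh yh).filter (fun i => s i = false), p i := by
  simp only [cost, G0p, G1p, G0m, G1m, filter_filter, sum_filter, ← sum_add_distrib]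
  refine sum_congr rfl fun i _ => ?_
  cases s i <;> cases sh i <;> cases yh i <;> simp

theorem objE_le_cost {N : ℕ} (sh yh : Fin N → Bool) (p : Fin N → ℝ) (s : Fin N → Bool) :
    objE sh yh p (chgA sh yh s) (chgB sh yh s) (chgC sh yh s) (chgD sh yh s) ≤ cost sh p s := by
  rw [cost_eq_sum_groups sh yh]
  unfold objE chgA chgB chgC chgD
  gcongr <;> exact Tmin_le_sum p (filter_subset _ _)

theorem exists_reconstruction_filter_eq {N : ℕ} (sh yh : Fin N → Bool)
    {A B C D : Finset (Fin N)} (hA : A ⊆ G0p sh yh) (hB : B ⊆ G1p sh yh)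
    (hC : C ⊆ G0m sh yh) (hD : D ⊆ G1m sh yh) :
    ∃ s : Fin N → Bool,
      (G0p sh yh).filter (fun i => s i = true) = A ∧
      (G1p sh yh).filter (fun i => s i = false) = B ∧
      (G0m sh yh).filter (fun i => s i = true) = C ∧
      (G1m sh yh).filter (fun i => s i = false) = D := by
  simp only [subset_iff, G0p, G1p, G0m, G1m, mem_filter, mem_univ, true_and] at hA hB hC hD
  refine ⟨fun i => if i ∈ A ∪ B ∪ C ∪ D then !sh i else sh i, ?_, ?_, ?_, ?_⟩ <;>
  · ext i
    specialize @hA i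
    specialize @hB i
    specialize @hC i
    specialize @hD i
    simp only [G0p, G1p, G0m, G1m, mem_filter, mem_univ, true_and, mem_union]
    revert hA hB hC hD
    cases sh i <;> cases yh i <;> simp +contextual

theorem exists_reconstruction_with_cost_objE (N : ℕ) (hN : 1 ≤ N)
    (sh yh : Fin N → Bool) (p : Fin N → ℝ) (hp : ∀ i, 0 ≤ p i)
    (a b c d : ℕ) (ha : a ≤ (G0p sh yh).card) (hb : b ≤ (G1p sh yh).card)
    (hc : c ≤ (G0m sh yh).card) (hd : d ≤ (G1m sh yh).card) :
    (∃ s : Fin N → Bool,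
      chgA sh yh s = a ∧ chgB sh yh s = b ∧ chgC sh yh s = c ∧ chgD sh yh s = d ∧
      cost sh p s = objE sh yh p a b c d) ∧
    IsLeast {x : ℝ | ∃ s : Fin N → Bool,
        chgA sh yh s = a ∧ chgB sh yh s = b ∧ chgC sh yh s = c ∧ chgD sh yh s = d ∧
        x = cost sh p s}
      (objE sh yh p a b c d) := by
  obtain ⟨A, hAG, rfl, hA⟩ := exists_subset_sum_eq_Tmin (G0p sh yh) p ha
  obtain ⟨B, hBG, rfl, hB⟩ := exists_subset_sum_eq_Tmin (G1p sh yh) p hb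
  obtain ⟨C, hCG, rfl, hC⟩ := exists_subset_sum_eq_Tmin (G0m sh yh) p hc
  obtain ⟨D, hDG, rfl, hD⟩ := exists_subset_sum_eq_Tmin (G1m sh yh) p hd
  obtain ⟨s, hsA, hsB, hsC, hsD⟩ := exists_reconstruction_filter_eq sh yh hAG hBG hCG hDG
  have hcost : cost sh p s = objE sh yh p A.card B.card C.card D.card := by
    rw [cost_eq_sum_groups sh yh, hsA, hsB, hsC, hsD, hA, hB, hC, hD, objE]
  have hs : chgA sh yh s = A.card ∧ chgB sh yh s = B.card ∧ chgC sh yh s = C.card ∧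
      chgD sh yh s = D.card :=
    ⟨congrArg card hsA, congrArg card hsB, congrArg card hsC, congrArg card hsD⟩
  obtain ⟨ha', hb', hc', hd'⟩ := hs
  refine ⟨⟨s, ha', hb', hc', hd', hcost⟩, ⟨s, ha', hb', hc', hd', hcost.symm⟩, ?_⟩
  rintro _ ⟨t, hta, htb, htc, htd, rfl⟩
  rw [← hta, ← htb, ← htc, ← htd]
  exact objE_le_cost sh yh p t
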